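/- arXiv:1510.00328 — 2 statements merged into one kernel-verified Lean document; each statement's English description precedes it below -/
import Mathlib

section
/- Let λ ∈ {−1, 1}, t* ∈ ℝ, x* ∈ E², and let ψ : ℝ × E² → ℝ be twice continuously differentiable and satisfy the decay condition at (t*, x*, λ). Then the functions x ↦ log‖x − x*‖·(□ψ)(t* + λ‖x − x*‖, x) and x ↦ ((log‖x − x*‖ + 2)/‖x − x*‖)·(∂_tψ)(t* + λ‖x − x*‖, x) are Lebesgue integrable on E² and ψ(t*, x*) = (1/(2π))·∫_{E²} log‖x − x*‖·(□ψ)(t* + λ‖x − x*‖, x) dx − (λ/(2π))·∫_{E²} ((log‖x − x*‖ + 2)/‖x − x*‖)·(∂_tψ)(t* + λ‖x − x*‖, x) dx. -/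
open MeasureTheory Real Filter

noncomputable def pd {n : ℕ} (i : Fin n) (f : EuclideanSpace ℝ (Fin n) → ℝ)
    (x : EuclideanSpace ℝ (Fin n)) : ℝ :=
  fderiv ℝ f x (EuclideanSpace.single i 1)

noncomputable def pdT {n : ℕ} (ψ : ℝ × EuclideanSpace ℝ (Fin n) → ℝ)
    (p : ℝ × EuclideanSpace ℝ (Fin n)) : ℝ :=
  deriv (fun s => ψ (s, p.2)) p.1

noncomputable def pdX {n : ℕ} (i : Fin n) (ψ : ℝ × EuclideanSpace ℝ (Fin n) → ℝ)
    (p : ℝ × EuclideanSpace ℝ (Fin n)) : ℝ :=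
  fderiv ℝ (fun y => ψ (p.1, y)) p.2 (EuclideanSpace.single i 1)

noncomputable def dAlem {n : ℕ} (ψ : ℝ × EuclideanSpace ℝ (Fin n) → ℝ)
    (p : ℝ × EuclideanSpace ℝ (Fin n)) : ℝ :=
  (∑ i, pdX i (pdX i ψ) p) - pdT (pdT ψ) p
/-- The decay condition of ψ at (t*, x*, λ): beyond some radius r*, for each m ∈ {0,1,2}
there are p_m > m and C_m > 0 bounding every pure m-th order partial derivative of ψ
(with respect to the time variable or a single space coordinate), evaluated along the
biased argument, by C_m * ‖x - x*‖ ^ (-p_m). -/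
def Decay {n : ℕ} (ψ : ℝ × EuclideanSpace ℝ (Fin n) → ℝ) (ts lam : ℝ)
    (xs : EuclideanSpace ℝ (Fin n)) : Prop :=
  ∃ rs : ℝ, 0 < rs ∧
    (∃ p C : ℝ, 0 < p ∧ 0 < C ∧ ∀ x, rs < ‖x - xs‖ →
      |ψ (ts + lam * ‖x - xs‖, x)| ≤ C * ‖x - xs‖ ^ (-p)) ∧
    (∃ p C : ℝ, 1 < p ∧ 0 < C ∧ ∀ x, rs < ‖x - xs‖ →
      |pdT ψ (ts + lam * ‖x - xs‖, x)| ≤ C * ‖x - xs‖ ^ (-p) ∧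
      ∀ i, |pdX i ψ (ts + lam * ‖x - xs‖, x)| ≤ C * ‖x - xs‖ ^ (-p)) ∧
    (∃ p C : ℝ, 2 < p ∧ 0 < C ∧ ∀ x, rs < ‖x - xs‖ →
      |pdT (pdT ψ) (ts + lam * ‖x - xs‖, x)| ≤ C * ‖x - xs‖ ^ (-p) ∧
      ∀ i, |pdX i (pdX i ψ) (ts + lam * ‖x - xs‖, x)| ≤ C * ‖x - xs‖ ^ (-p))

abbrev E2 := EuclideanSpace ℝ (Fin 2)

noncomputable def ee (θ : ℝ) : E2 :=
  Real.cos θ • EuclideanSpace.single 0 1 + Real.sin θ • EuclideanSpace.single 1 1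

noncomputable def ed (θ : ℝ) : E2 :=
  (-Real.sin θ) • EuclideanSpace.single 0 1 + Real.cos θ • EuclideanSpace.single 1 1

lemma norm_ee (r θ : ℝ) : ‖r • ee θ‖ = |r| := by
  rw [norm_smul]
  have : ‖ee θ‖ = 1 := by
    rw [EuclideanSpace.norm_eq]
    simp [ee]
  rw [this]; simp

lemma hasDerivAt_ee (θ : ℝ) : HasDerivAt ee (ed θ) θ :=
  ((Real.hasDerivAt_cos θ).smul_const _).add ((Real.hasDerivAt_sin θ).smul_const _)

lemma hasDerivAt_ed (θ : ℝ) : HasDerivAt ed (-ee θ) θ := by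
  have := (((Real.hasDerivAt_sin θ).neg).smul_const (EuclideanSpace.single 0 1 : E2)).add
    ((Real.hasDerivAt_cos θ).smul_const (EuclideanSpace.single 1 1 : E2))
  have e : -ee θ = (-Real.cos θ) • (EuclideanSpace.single 0 1 : E2) +
      (-Real.sin θ) • (EuclideanSpace.single 1 1 : E2) := by
    simp only [ee]; module
  rw [e]; exact this

/-- the volume preserving map to the Euclidean plane -/
noncomputable def toE2 : (ℝ × ℝ) ≃ᵐ E2 :=
  MeasurableEquiv.finTwoArrow.symm.trans (MeasurableEquiv.toLp 2 (Fin 2 → ℝ))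

lemma toE2_mp : MeasurePreserving toE2 volume volume := by
  have h1 := (volume_preserving_finTwoArrow ℝ).symm
  have h2 := PiLp.volume_preserving_toLp (Fin 2)
  exact h2.comp h1

lemma toE2_polar (p : ℝ × ℝ) : toE2 (polarCoord.symm p) = p.1 • ee p.2 := by
  ext i
  fin_cases i <;> simp [toE2, ee, polarCoord, MeasurableEquiv.finTwoArrow] 

lemma polar_int (f : E2 → ℝ) (hf : Integrable f) (xs : E2) :
    IntegrableOn (fun r : ℝ => ∫ θ in (-π)..π, r * f (xs + r • ee θ)) (Set.Ioi 0) ∧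
    ∫ x, f x = ∫ r in Set.Ioi (0:ℝ), ∫ θ in (-π)..π, r * f (xs + r • ee θ) := by
  have h1 : Integrable (fun y => f (xs + y)) := hf.comp_add_left xs
  have h2 : Integrable (fun p => f (xs + toE2 p)) :=
    (toE2_mp.integrable_comp_emb toE2.measurableEmbedding).2 h1
  have h3 : IntegrableOn (fun p : ℝ × ℝ => p.1 • f (xs + toE2 (polarCoord.symm p)))
      polarCoord.target := by
    have := (integrableOn_image_iff_integrableOn_abs_det_fderiv_smul volume
      (s := polarCoord.target) (f := polarCoord.symm) polarCoord.open_target.measurableSet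
      (fun p _ => (hasFDerivAt_polarCoord_symm p).hasFDerivWithinAt) polarCoord.symm.injOn
      (fun p => f (xs + toE2 p))).1 h2.integrableOn
    refine this.congr_fun ?_ polarCoord.open_target.measurableSet
    intro p hp
    simp only [det_fderivPolarCoordSymm]
    rw [abs_of_pos hp.1]
  have h4 : ∫ x, f x = ∫ p in polarCoord.target, p.1 • f (xs + toE2 (polarCoord.symm p)) := by
    rw [integral_comp_polarCoord_symm (fun p => f (xs + toE2 p)),
      toE2_mp.integral_comp toE2.measurableEmbedding (fun y => f (xs + y)),
      integral_add_left_eq_self f xs]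
  simp only [toE2_polar, smul_eq_mul] at h3 h4
  have ht : polarCoord.target = Set.Ioi (0:ℝ) ×ˢ Set.Ioo (-π) π := rfl
  rw [ht] at h3 h4
  have hI : ∀ r : ℝ, ∫ θ in (-π)..π, r * f (xs + r • ee θ)
      = ∫ θ in Set.Ioo (-π) π, r * f (xs + r • ee θ) := by
    intro r
    rw [intervalIntegral.integral_of_le (by linarith [Real.pi_pos]), integral_Ioc_eq_integral_Ioo]
  simp only [hI]
  constructor
  · rw [IntegrableOn, Measure.volume_eq_prod, ← Measure.prod_restrict] at h3
    exact h3.integral_prod_left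
  · rw [h4, Measure.volume_eq_prod, setIntegral_prod]
    rwa [Measure.volume_eq_prod] at h3

lemma deriv_int (f f' : ℝ → ℝ → ℝ) (hf : Continuous (fun p : ℝ × ℝ => f p.1 p.2))
    (hf' : Continuous (fun p : ℝ × ℝ => f' p.1 p.2))
    (h : ∀ r θ, HasDerivAt (fun s => f s θ) (f' r θ) r) (a b r : ℝ) :
    HasDerivAt (fun r => ∫ θ in a..b, f r θ) (∫ θ in a..b, f' r θ) r := by
  have hc : ∀ r, Continuous (f r) := fun r => hf.comp (by fun_prop : Continuous fun θ => (r, θ))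
  have hc' : ∀ r, Continuous (f' r) := fun r => hf'.comp (by fun_prop : Continuous fun θ => (r, θ))
  obtain ⟨M, hM⟩ := ((isCompact_closedBall r 1).prod (isCompact_uIcc (a := a) (b := b))).exists_bound_of_continuousOn hf'.continuousOn
  refine (intervalIntegral.hasDerivAt_integral_of_dominated_loc_of_deriv_le
    (s := Metric.closedBall r 1) (bound := fun _ => M)
    (Metric.closedBall_mem_nhds r one_pos) (Eventually.of_forall fun x => (hc x).aestronglyMeasurable)
    ((hc r).intervalIntegrable _ _) (hc' r).aestronglyMeasurable
    (Eventually.of_forall fun θ hθ x hx => hM (x, θ) ⟨hx, Set.uIoc_subset_uIcc hθ⟩)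
    intervalIntegrable_const (Eventually.of_forall fun θ _ x _ => h x θ)).2

lemma tail_int (q R : ℝ) (hq : 1 < q) (hR : 1 ≤ R) :
    IntegrableOn (fun r : ℝ => (|Real.log r| + 2) * r ^ (-q)) (Set.Ioi R) := by
  set ε := (q - 1) / 2 with hε
  have hε0 : 0 < ε := by rw [hε]; linarith
  have h1 : IntegrableOn (fun r : ℝ => (1/ε) * r ^ (ε - q) + 2 * r ^ (-q)) (Set.Ioi R) :=
    ((integrableOn_Ioi_rpow_of_lt (by rw [hε]; linarith) (by linarith)).const_mul _).add
      ((integrableOn_Ioi_rpow_of_lt (by linarith) (by linarith)).const_mul _)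
  refine Integrable.mono' h1 (by fun_prop) ?_
  refine (ae_restrict_iff' measurableSet_Ioi).2 (Eventually.of_forall fun r hr => ?_)
  have hr0 : 0 < r := by linarith [Set.mem_Ioi.1 hr]
  have hr1 : 1 ≤ r := by linarith [Set.mem_Ioi.1 hr]
  rw [Real.norm_of_nonneg (by positivity), abs_of_nonneg (Real.log_nonneg hr1), add_mul,
    sub_eq_add_neg, Real.rpow_add hr0]
  have := Real.log_le_rpow_div hr0.le hε0
  have h2 := mul_le_mul_of_nonneg_right this (Real.rpow_nonneg hr0.le (-q))
  have e : r ^ ε / ε * r ^ (-q) = 1/ε * (r^ε * r^(-q)) := by ring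
  linarith

lemma int_lem (w : ℝ → ℝ) (hw : Measurable w) (k : E2 → ℝ) (hk : Continuous k) (xs : E2)
    (rs q C M0 : ℝ) (hq : 1 < q) (hC : 0 < C)
    (hdec : ∀ x, rs < ‖x - xs‖ → ‖x - xs‖ * |w ‖x - xs‖| * |k x| ≤
      C * ((|Real.log ‖x - xs‖| + 2) * ‖x - xs‖ ^ (-q)))
    (hloc : ∀ R r, 0 < r → r ≤ R → r * |w r| ≤ (M0 + R) * (|Real.log r| + 2)) (hM0 : 0 ≤ M0) :
    Integrable (fun x : E2 => w ‖x - xs‖ * k x) := by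
  set R := max rs 1 with hR
  have hR1 : 1 ≤ R := le_max_right _ _
  obtain ⟨M, hM⟩ := (isCompact_closedBall xs R).exists_bound_of_continuousOn hk.continuousOn
  have hMn : 0 ≤ M := (norm_nonneg _).trans (hM xs (by simp; linarith))
  set g : ℝ → ℝ := fun r => if r ≤ R then M * (M0 + R) * (|Real.log r| + 2) / r else
    C * ((|Real.log r| + 2) * r ^ (-q)) / r with hg
  have hgi : Integrable (fun x : E2 => g ‖x‖) := by
    rw [integrable_fun_norm_addHaar]
    have hs : Set.Ioi (0:ℝ) = Set.Ioc 0 R ∪ Set.Ioi R := by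
      rw [Set.Ioc_union_Ioi_eq_Ioi (by linarith)]
    simp only [finrank_euclideanSpace, Fintype.card_fin, smul_eq_mul, Nat.add_one_sub_one, pow_one]
    rw [hs]
    refine IntegrableOn.union ?_ ?_
    · have : IntegrableOn (fun r : ℝ => M * (M0 + R) * (|Real.log r| + 2)) (Set.Ioc 0 R) := by
        have h1 : IntervalIntegrable Real.log volume 0 R := intervalIntegral.intervalIntegrable_log'
        have h2 := (h1.abs.add (intervalIntegrable_const (c := (2:ℝ)))).const_mul (M * (M0 + R))
        exact (intervalIntegrable_iff_integrableOn_Ioc_of_le (by linarith)).1 h2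
      refine this.congr_fun ?_ measurableSet_Ioc
      intro r hr
      have : r ≠ 0 := hr.1.ne'
      simp only [hg, if_pos hr.2]
      field_simp
    · have h3 : IntegrableOn (fun r : ℝ => C * ((|Real.log r| + 2) * r ^ (-q))) (Set.Ioi R) :=
        (tail_int q R hq hR1).const_mul C
      refine h3.congr_fun ?_ measurableSet_Ioi
      intro r hr
      have hr' : R < r := hr
      have : r ≠ 0 := by linarith
      simp only [hg, if_neg (not_le.2 hr')]
      field_simp
  have hgi' : Integrable (fun x : E2 => g ‖x - xs‖) := hgi.comp_sub_right xs
  refine hgi'.mono' ?_ ?_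
  · exact ((hw.comp (by fun_prop : Measurable fun x : E2 => ‖x - xs‖)).mul hk.measurable).aestronglyMeasurable
  · have : ∀ᵐ x : E2, x ≠ xs := by
      simp [ae_iff, measure_singleton]
    filter_upwards [this] with x hx
    have hr : 0 < ‖x - xs‖ := norm_pos_iff.2 (sub_ne_zero.2 hx)
    simp only [hg, norm_mul, Real.norm_eq_abs]
    split_ifs with h
    · rw [le_div_iff₀ hr]
      have h1 := hloc R _ hr h
      have h2 := hM x (by simpa [dist_eq_norm] using h)
      rw [Real.norm_eq_abs] at h2
      have := mul_le_mul h2 h1 (by positivity) hMn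
      linarith
    · rw [le_div_iff₀ hr]
      have h1 := hdec x (lt_of_le_of_lt (le_max_left _ _) (not_le.1 h))
      linarith

lemma pdT_eq (g : ℝ × E2 → ℝ) (hg : Differentiable ℝ g) (p : ℝ × E2) :
    pdT g p = fderiv ℝ g p (1, 0) := by
  have h : HasDerivAt (fun s : ℝ => ((s, p.2) : ℝ × E2)) (1, 0) p.1 :=
    (hasDerivAt_id p.1).prodMk (hasDerivAt_const _ _)
  exact ((hg (p.1, p.2)).hasFDerivAt.comp_hasDerivAt p.1 h).deriv

lemma pdX_eq (i : Fin 2) (g : ℝ × E2 → ℝ) (hg : Differentiable ℝ g) (p : ℝ × E2) :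
    pdX i g p = fderiv ℝ g p (0, EuclideanSpace.single i 1) := by
  have h : HasFDerivAt (fun y : E2 => ((p.1, y) : ℝ × E2)) (ContinuousLinearMap.inr ℝ ℝ E2) p.2 :=
    hasFDerivAt_prodMk_right _ _
  have := ((hg (p.1, p.2)).hasFDerivAt.comp p.2 h).fderiv
  unfold pdX
  rw [show (fun y => g (p.1, y)) = g ∘ (fun y => (p.1, y)) from rfl, this]
  simp

lemma contDiff_pdT {n m : WithTop ℕ∞} (g : ℝ × E2 → ℝ) (hg : ContDiff ℝ n g) (h : m + 1 ≤ n) :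
    ContDiff ℝ m (pdT g) := by
  have h1 : Differentiable ℝ g := hg.differentiable (by
    rintro rfl; simp at h)
  have : pdT g = fun p => fderiv ℝ g p (1, 0) := funext (pdT_eq g h1)
  rw [this]
  exact (hg.fderiv_right h).clm_apply contDiff_const

lemma contDiff_pdX {n m : WithTop ℕ∞} (i : Fin 2) (g : ℝ × E2 → ℝ) (hg : ContDiff ℝ n g) (h : m + 1 ≤ n) :
    ContDiff ℝ m (pdX i g) := by
  have h1 : Differentiable ℝ g := hg.differentiable (by
    rintro rfl; simp at h)
  have : pdX i g = fun p => fderiv ℝ g p (0, EuclideanSpace.single i 1) := funext (pdX_eq i g h1)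
  rw [this]
  exact (hg.fderiv_right h).clm_apply contDiff_const

lemma fderiv_fderiv_apply (g : ℝ × E2 → ℝ) (hg : ContDiff ℝ 2 g) (p u v : ℝ × E2) :
    fderiv ℝ (fun p => fderiv ℝ g p u) p v = fderiv ℝ (fderiv ℝ g) p v u := by
  have h : ContDiff ℝ 1 (fderiv ℝ g) := hg.fderiv_right (by norm_num)
  have := ((h.differentiable (by norm_num) p).hasFDerivAt.clm_apply (hasFDerivAt_const u p)).fderiv
  rw [this]; simp

lemma symmTX (i : Fin 2) (g : ℝ × E2 → ℝ) (hg : ContDiff ℝ 2 g) (p : ℝ × E2) :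
    pdT (pdX i g) p = pdX i (pdT g) p := by
  have h0 := hg.differentiable (by norm_num)
  rw [pdT_eq _ ((contDiff_pdX i g hg (m := 1) (by norm_num)).differentiable (by norm_num)),
    pdX_eq i _ ((contDiff_pdT g hg (m := 1) (by norm_num)).differentiable (by norm_num)),
    show pdX i g = fun p => fderiv ℝ g p (0, EuclideanSpace.single i 1) from funext (pdX_eq i g h0),
    show pdT g = fun p => fderiv ℝ g p (1, 0) from funext (pdT_eq g h0),
    fderiv_fderiv_apply g hg, fderiv_fderiv_apply g hg]
  exact (hg.contDiffAt.isSymmSndFDerivAt (by simp)) _ _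

lemma symmXX (i j : Fin 2) (g : ℝ × E2 → ℝ) (hg : ContDiff ℝ 2 g) (p : ℝ × E2) :
    pdX j (pdX i g) p = pdX i (pdX j g) p := by
  have h0 := hg.differentiable (by norm_num)
  rw [pdX_eq j _ ((contDiff_pdX i g hg (m := 1) (by norm_num)).differentiable (by norm_num)),
    pdX_eq i _ ((contDiff_pdX j g hg (m := 1) (by norm_num)).differentiable (by norm_num)),
    show pdX i g = fun p => fderiv ℝ g p (0, EuclideanSpace.single i 1) from funext (pdX_eq i g h0),
    show pdX j g = fun p => fderiv ℝ g p (0, EuclideanSpace.single j 1) from funext (pdX_eq j g h0),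
    fderiv_fderiv_apply g hg, fderiv_fderiv_apply g hg]
  exact (hg.contDiffAt.isSymmSndFDerivAt (by simp)) _ _

lemma fderiv_expand (g : ℝ × E2 → ℝ) (hg : Differentiable ℝ g) (p : ℝ × E2) (a b c : ℝ) :
    fderiv ℝ g p (a, b • EuclideanSpace.single 0 1 + c • EuclideanSpace.single 1 1)
      = a * pdT g p + b * pdX 0 g p + c * pdX 1 g p := by
  rw [pdT_eq g hg, pdX_eq 0 g hg, pdX_eq 1 g hg]
  have : ((a, b • EuclideanSpace.single 0 1 + c • EuclideanSpace.single 1 1) : ℝ × E2)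
    = a • ((1, 0) : ℝ × E2) + b • ((0, EuclideanSpace.single 0 1) : ℝ × E2)
      + c • ((0, EuclideanSpace.single 1 1) : ℝ × E2) := by
    ext1 <;> simp
  rw [this, map_add, map_add, map_smul, map_smul, map_smul]; simp

noncomputable def gam (ts lam : ℝ) (xs : E2) (r θ : ℝ) : ℝ × E2 := (ts + lam * r, xs + r • ee θ)

lemma cont_ee : Continuous ee := by unfold ee; fun_prop

lemma cont_gam (ts lam : ℝ) (xs : E2) : Continuous (fun p : ℝ × ℝ => gam ts lam xs p.1 p.2) := by
  unfold gam
  have := cont_ee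
  fun_prop

lemma deriv_r (g : ℝ × E2 → ℝ) (hg : Differentiable ℝ g) (ts lam : ℝ) (xs : E2) (r θ : ℝ) :
    HasDerivAt (fun r => g (gam ts lam xs r θ)) (lam * pdT g (gam ts lam xs r θ)
      + Real.cos θ * pdX 0 g (gam ts lam xs r θ) + Real.sin θ * pdX 1 g (gam ts lam xs r θ)) r := by
  have h : HasDerivAt (fun r => gam ts lam xs r θ) (lam, ee θ) r := by
    have h1 : HasDerivAt (fun r => ts + lam * r) lam r := by
      simpa using ((hasDerivAt_id r).const_mul lam).const_add ts
    have h2 : HasDerivAt (fun r : ℝ => xs + r • ee θ) (ee θ) r := by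
      simpa using ((hasDerivAt_id r).smul_const (ee θ)).const_add xs
    exact h1.prodMk h2
  have := (hg (gam ts lam xs r θ)).hasFDerivAt.comp_hasDerivAt r h
  rw [ee, fderiv_expand g hg] at this
  exact this

lemma deriv_th (g : ℝ × E2 → ℝ) (hg : Differentiable ℝ g) (ts lam : ℝ) (xs : E2) (r θ : ℝ) :
    HasDerivAt (fun θ => g (gam ts lam xs r θ)) (r * (-Real.sin θ * pdX 0 g (gam ts lam xs r θ)
      + Real.cos θ * pdX 1 g (gam ts lam xs r θ))) θ := by
  have h : HasDerivAt (fun θ => gam ts lam xs r θ) (0, r • ed θ) θ := by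
    exact (hasDerivAt_const θ _).prodMk (((hasDerivAt_ee θ).const_smul r).const_add xs)
  have := (hg (gam ts lam xs r θ)).hasFDerivAt.comp_hasDerivAt θ h
  rw [ed, smul_add, smul_smul, smul_smul, fderiv_expand g hg] at this
  refine this.congr_deriv ?_
  ring

lemma decay_int (f : ℝ → ℝ → ℝ) (rs C p : ℝ) (h : ∀ r θ, rs < r → |f r θ| ≤ C * r ^ (-p)) :
    ∀ r, rs < r → |∫ θ in (-π)..π, f r θ| ≤ (C * (2 * π)) * r ^ (-p) := by
  intro r hr
  have := intervalIntegral.norm_integral_le_of_norm_le_const (a := -π) (b := π) (f := f r)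
    (C := C * r ^ (-p)) (fun θ _ => h r θ hr)
  rw [Real.norm_eq_abs, abs_of_pos (a := π - -π) (by linarith [Real.pi_pos])] at this
  linarith

lemma lim0 (A : ℝ → ℝ) (rs K p : ℝ) (hp : 0 < p) (h : ∀ r, rs < r → |A r| ≤ K * r ^ (-p)) :
    Tendsto A atTop (nhds 0) := by
  have h1 : Tendsto (fun r : ℝ => K * r ^ (-p)) atTop (nhds 0) := by
    simpa using (tendsto_rpow_neg_atTop hp).const_mul K
  refine squeeze_zero_norm' ?_ h1
  filter_upwards [eventually_gt_atTop rs] with r hr using h r hr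

lemma lim1 (A : ℝ → ℝ) (rs K p : ℝ) (hp : 1 < p) (h : ∀ r, rs < r → |A r| ≤ K * r ^ (-p)) :
    Tendsto (fun r => r * Real.log r * A r) atTop (nhds 0) := by
  have h1 : Tendsto (fun r : ℝ => K * (Real.log r / r ^ (p - 1))) atTop (nhds 0) := by
    simpa using ((isLittleO_log_rpow_atTop (sub_pos.2 hp)).tendsto_div_nhds_zero).const_mul K
  refine squeeze_zero_norm' ?_ h1
  filter_upwards [eventually_gt_atTop rs, eventually_gt_atTop 1] with r hr hr1
  have hr0 : 0 < r := by linarith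
  have hl := Real.log_pos hr1
  rw [norm_mul, norm_mul, Real.norm_of_nonneg hr0.le, Real.norm_of_nonneg hl.le, Real.norm_eq_abs]
  calc r * Real.log r * |A r| ≤ r * Real.log r * (K * r ^ (-p)) := by
        gcongr; exact h r hr
    _ = K * (Real.log r / r ^ (p - 1)) := by
        rw [Real.rpow_sub hr0, Real.rpow_neg hr0.le, Real.rpow_one]
        field_simp

lemma lin5 (a b c1 c2 c3 c4 c5 : ℝ) (f1 f2 f3 f4 f5 : ℝ → ℝ) (h1 : Continuous f1)
    (h2 : Continuous f2) (h3 : Continuous f3) (h4 : Continuous f4) (h5 : Continuous f5) :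
    ∫ θ in a..b, (c1 * f1 θ + c2 * f2 θ + c3 * f3 θ + c4 * f4 θ + c5 * f5 θ)
    = c1 * (∫ θ in a..b, f1 θ) + c2 * (∫ θ in a..b, f2 θ) + c3 * (∫ θ in a..b, f3 θ)
      + c4 * (∫ θ in a..b, f4 θ) + c5 * (∫ θ in a..b, f5 θ) := by
  rw [intervalIntegral.integral_add, intervalIntegral.integral_add, intervalIntegral.integral_add,
    intervalIntegral.integral_add]
  · simp only [intervalIntegral.integral_const_mul]
  all_goals exact Continuous.intervalIntegrable (by fun_prop) _ _

/-- the boundary-free special second integro-differential formula in the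
infinite two-dimensional Euclidean space (exhibiting the dispersive extra term). -/
theorem stmt_17 (lam : ℝ) (hlam : lam = -1 ∨ lam = 1)
    (ts : ℝ) (xs : EuclideanSpace ℝ (Fin 2))
    (ψ : ℝ × EuclideanSpace ℝ (Fin 2) → ℝ) (hψ : ContDiff ℝ 2 ψ)
    (hdecay : Decay ψ ts lam xs) :
    Integrable (fun x : EuclideanSpace ℝ (Fin 2) =>
      Real.log ‖x - xs‖ * dAlem ψ (ts + lam * ‖x - xs‖, x)) ∧
    Integrable (fun x : EuclideanSpace ℝ (Fin 2) =>
      ((Real.log ‖x - xs‖ + 2) / ‖x - xs‖) * pdT ψ (ts + lam * ‖x - xs‖, x)) ∧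
    ψ (ts, xs)
      = (1 / (2 * Real.pi)) * (∫ x : EuclideanSpace ℝ (Fin 2),
            Real.log ‖x - xs‖ * dAlem ψ (ts + lam * ‖x - xs‖, x))
        - (lam / (2 * Real.pi)) * (∫ x : EuclideanSpace ℝ (Fin 2),
            ((Real.log ‖x - xs‖ + 2) / ‖x - xs‖) * pdT ψ (ts + lam * ‖x - xs‖, x)) := by
  have hl2 : lam * lam = 1 := by rcases hlam with h | h <;> simp [h]
  have hl1 : |lam| = 1 := by rcases hlam with h | h <;> simp [h]
  obtain ⟨rs, hrs, ⟨p0, C0, hp0, hC0, hd0⟩, ⟨p1, C1, hp1, hC1, hd1⟩, ⟨p2, C2, hp2, hC2, hd2⟩⟩ :=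
    hdecay
  have hψd : Differentiable ℝ ψ := hψ.differentiable (by norm_num)
  have cT : ContDiff ℝ 1 (pdT ψ) := contDiff_pdT ψ hψ (by norm_num)
  have cX : ∀ i, ContDiff ℝ 1 (pdX i ψ) := fun i => contDiff_pdX i ψ hψ (by norm_num)
  have dT : Differentiable ℝ (pdT ψ) := cT.differentiable (by norm_num)
  have dX : ∀ i, Differentiable ℝ (pdX i ψ) := fun i => (cX i).differentiable (by norm_num)
  have c0T := cT.continuous
  have c0X : ∀ i, Continuous (pdX i ψ) := fun i => (cX i).continuous
  have cTT : Continuous (pdT (pdT ψ)) := (contDiff_pdT (m := 0) _ cT (by norm_num)).continuous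
  have cXT : ∀ i, Continuous (pdX i (pdT ψ)) := fun i =>
    (contDiff_pdX (m := 0) i _ cT (by norm_num)).continuous
  have cXX : ∀ i j, Continuous (pdX i (pdX j ψ)) := fun i j =>
    (contDiff_pdX (m := 0) i _ (cX j) (by norm_num)).continuous
  have cbox : Continuous (dAlem ψ) := by
    unfold dAlem
    exact (continuous_finsetSum _ fun i _ => cXX i i).sub cTT
  have carg : Continuous (fun x : E2 => ((ts + lam * ‖x - xs‖, x) : ℝ × E2)) := by fun_prop
  have I1 : Integrable (fun x : E2 => Real.log ‖x - xs‖ * dAlem ψ (ts + lam * ‖x - xs‖, x)) := by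
    refine int_lem Real.log Real.measurable_log _ (cbox.comp carg) xs rs (p2 - 1) (3 * C2) 1
      (by linarith) (by positivity) ?_ ?_ zero_le_one
    · intro x hx
      have hr : 0 < ‖x - xs‖ := by linarith
      obtain ⟨hT, hX⟩ := hd2 x hx
      have h0 := hX 0
      have h1 := hX 1
      have hb : |dAlem ψ (ts + lam * ‖x - xs‖, x)| ≤ 3 * C2 * ‖x - xs‖ ^ (-p2) := by
        simp only [dAlem, Fin.sum_univ_two]
        rw [abs_le] at *
        constructor <;> linarith [hT.1, hT.2, h0.1, h0.2, h1.1, h1.2]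
      have e : ‖x - xs‖ ^ (-(p2 - 1)) = ‖x - xs‖ * ‖x - xs‖ ^ (-p2) := by
        rw [show -(p2 - 1) = 1 + -p2 by ring, Real.rpow_add hr, Real.rpow_one]
      rw [e]
      have hpos := Real.rpow_pos_of_pos hr (-p2)
      calc ‖x - xs‖ * |Real.log ‖x - xs‖| * |dAlem ψ (ts + lam * ‖x - xs‖, x)|
          ≤ ‖x - xs‖ * (|Real.log ‖x - xs‖| + 2) * (3 * C2 * ‖x - xs‖ ^ (-p2)) := by
            gcongr; linarith
        _ = _ := by ring
    · intro R r hr hrR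
      have := abs_nonneg (Real.log r)
      gcongr <;> linarith
  have I2 : Integrable (fun x : E2 =>
      ((Real.log ‖x - xs‖ + 2) / ‖x - xs‖) * pdT ψ (ts + lam * ‖x - xs‖, x)) := by
    have key : ∀ r : ℝ, 0 < r → r * |(Real.log r + 2) / r| ≤ |Real.log r| + 2 := by
      intro r hr
      rw [abs_div, abs_of_pos hr, mul_div_cancel₀ _ hr.ne']
      exact (abs_add_le _ _).trans (by norm_num)
    refine int_lem (fun r => (Real.log r + 2) / r) (by fun_prop) _ (c0T.comp carg) xs rs p1 C1 1
      hp1 hC1 ?_ ?_ zero_le_one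
    · intro x hx
      have hr : 0 < ‖x - xs‖ := by linarith
      have hT := (hd1 x hx).1
      have := mul_le_mul (key _ hr) hT (abs_nonneg _) (by positivity)
      simp only [Function.comp]
      linarith
    · intro R r hr hrR
      have := key r hr
      have := abs_nonneg (Real.log r)
      nlinarith
  refine ⟨I1, I2, ?_⟩
  set γ := gam ts lam xs with hγ
  have cγ : Continuous (fun p : ℝ × ℝ => γ p.1 p.2) := cont_gam ts lam xs
  have cγr : ∀ r, Continuous (γ r) := fun r => cγ.comp (by fun_prop : Continuous fun θ => (r, θ))
  have narg : ∀ r θ, 0 < r → ((ts + lam * ‖xs + r • ee θ - xs‖, xs + r • ee θ) : ℝ × E2) = γ r θ := by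
    intro r θ hr
    rw [add_sub_cancel_left, norm_ee, abs_of_pos hr]; rfl
  have nn : ∀ r θ, 0 < r → ‖xs + r • ee θ - xs‖ = r := by
    intro r θ hr
    rw [add_sub_cancel_left, norm_ee, abs_of_pos hr]
  set F1 : ℝ → ℝ → ℝ := fun r θ => lam * pdT ψ (γ r θ) + Real.cos θ * pdX 0 ψ (γ r θ)
    + Real.sin θ * pdX 1 ψ (γ r θ) with hF1
  set G1 : ℝ → ℝ → ℝ := fun r θ => lam * pdT (pdT ψ) (γ r θ) + Real.cos θ * pdX 0 (pdT ψ) (γ r θ)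
    + Real.sin θ * pdX 1 (pdT ψ) (γ r θ) with hG1
  set F2 : ℝ → ℝ → ℝ := fun r θ => lam * G1 r θ
    + Real.cos θ * (lam * pdX 0 (pdT ψ) (γ r θ) + Real.cos θ * pdX 0 (pdX 0 ψ) (γ r θ)
    + Real.sin θ * pdX 1 (pdX 0 ψ) (γ r θ))
    + Real.sin θ * (lam * pdX 1 (pdT ψ) (γ r θ) + Real.cos θ * pdX 0 (pdX 1 ψ) (γ r θ)
    + Real.sin θ * pdX 1 (pdX 1 ψ) (γ r θ)) with hF2
  set Ft : ℝ → ℝ → ℝ := fun r θ => r * (-Real.sin θ * pdX 0 ψ (γ r θ)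
    + Real.cos θ * pdX 1 ψ (γ r θ)) with hFt
  set Ftt : ℝ → ℝ → ℝ := fun r θ => r * (-Real.cos θ * pdX 0 ψ (γ r θ)
    + -Real.sin θ * (r * (-Real.sin θ * pdX 0 (pdX 0 ψ) (γ r θ)
      + Real.cos θ * pdX 1 (pdX 0 ψ) (γ r θ)))
    + (-Real.sin θ * pdX 1 ψ (γ r θ)
    + Real.cos θ * (r * (-Real.sin θ * pdX 0 (pdX 1 ψ) (γ r θ)
      + Real.cos θ * pdX 1 (pdX 1 ψ) (γ r θ))))) with hFtt
  have cc : ∀ g : ℝ × E2 → ℝ, Continuous g → Continuous (fun p : ℝ × ℝ => g (γ p.1 p.2)) :=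
    fun g hg => hg.comp cγ
  have k1 := cc _ hψ.continuous
  have k2 := cc _ c0T
  have k3 := fun i => cc _ (c0X i)
  have k4 := cc _ cTT
  have k5 := fun i => cc _ (cXT i)
  have k6 := fun i j => cc _ (cXX i j)
  have cF1 : Continuous (fun p : ℝ × ℝ => F1 p.1 p.2) := by
    simp only [hF1]
    have := k3 0
    have := k3 1
    fun_prop
  have cG1 : Continuous (fun p : ℝ × ℝ => G1 p.1 p.2) := by
    simp only [hG1]
    have := k5 0
    have := k5 1
    fun_prop
  have cF2 : Continuous (fun p : ℝ × ℝ => F2 p.1 p.2) := by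
    simp only [hF2]
    have := k5 0
    have := k5 1
    have := k6 0 0
    have := k6 1 1
    have := k6 0 1
    have := k6 1 0
    fun_prop
  have cFtt : Continuous (fun p : ℝ × ℝ => Ftt p.1 p.2) := by
    simp only [hFtt]
    have := k3 0
    have := k3 1
    have := k6 0 0
    have := k6 1 1
    have := k6 0 1
    have := k6 1 0
    fun_prop
  have sl : ∀ f : ℝ → ℝ → ℝ, Continuous (fun p : ℝ × ℝ => f p.1 p.2) → ∀ r, Continuous (f r) :=
    fun f hf r => hf.comp (by fun_prop : Continuous fun θ => (r, θ))
  -- derivatives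
  have DA : ∀ r, HasDerivAt (fun r => ∫ θ in (-π)..π, ψ (γ r θ)) (∫ θ in (-π)..π, F1 r θ) r :=
    fun r => deriv_int (fun r θ => ψ (γ r θ)) F1 k1 cF1
      (fun r θ => deriv_r ψ hψd ts lam xs r θ) _ _ r
  have DB : ∀ r, HasDerivAt (fun r => ∫ θ in (-π)..π, pdT ψ (γ r θ)) (∫ θ in (-π)..π, G1 r θ) r :=
    fun r => deriv_int (fun r θ => pdT ψ (γ r θ)) G1 k2 cG1
      (fun r θ => deriv_r _ dT ts lam xs r θ) _ _ r
  have DA1 : ∀ r, HasDerivAt (fun r => ∫ θ in (-π)..π, F1 r θ) (∫ θ in (-π)..π, F2 r θ) r := by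
    refine fun r => deriv_int F1 F2 cF1 cF2 (fun r θ => ?_) _ _ r
    have h := (((deriv_r _ dT ts lam xs r θ).const_mul lam).add
      ((deriv_r _ (dX 0) ts lam xs r θ).const_mul (Real.cos θ))).add
      ((deriv_r _ (dX 1) ts lam xs r θ).const_mul (Real.sin θ))
    rw [symmTX 0 ψ hψ, symmTX 1 ψ hψ] at h
    exact h
  have Z : ∀ r, ∫ θ in (-π)..π, Ftt r θ = 0 := by
    intro r
    have h : ∀ θ, HasDerivAt (Ft r) (Ftt r θ) θ := by
      intro θ
      have h1 := ((((Real.hasDerivAt_sin θ).neg).mul (deriv_th _ (dX 0) ts lam xs r θ)).add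
        ((Real.hasDerivAt_cos θ).mul (deriv_th _ (dX 1) ts lam xs r θ))).const_mul r
      exact h1
    rw [intervalIntegral.integral_eq_sub_of_hasDerivAt (fun θ _ => h θ)
      ((sl Ftt cFtt r).intervalIntegrable _ _)]
    have : γ r (-π) = γ r π := by simp [hγ, gam, ee]
    simp [hFt, this]
  set A : ℝ → ℝ := fun r => ∫ θ in (-π)..π, ψ (γ r θ) with hA
  set A1 : ℝ → ℝ := fun r => ∫ θ in (-π)..π, F1 r θ with hA1
  set B : ℝ → ℝ := fun r => ∫ θ in (-π)..π, pdT ψ (γ r θ) with hB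
  set H : E2 → ℝ := fun x => Real.log ‖x - xs‖ * dAlem ψ (ts + lam * ‖x - xs‖, x)
    - lam * (((Real.log ‖x - xs‖ + 2) / ‖x - xs‖) * pdT ψ (ts + lam * ‖x - xs‖, x)) with hH
  have IH : Integrable H := I1.sub (I2.const_mul lam)
  have hHint : ∫ x, H x = (∫ x : E2, Real.log ‖x - xs‖ * dAlem ψ (ts + lam * ‖x - xs‖, x))
      - lam * ∫ x : E2, ((Real.log ‖x - xs‖ + 2) / ‖x - xs‖) * pdT ψ (ts + lam * ‖x - xs‖, x) := by
    rw [integral_sub I1 (I2.const_mul lam), integral_const_mul]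
  obtain ⟨J1, J2⟩ := polar_int H IH xs
  -- the inner integral
  have inner : ∀ r, 0 < r → ∫ θ in (-π)..π, r * H (xs + r • ee θ)
      = (r * Real.log r) * (∫ θ in (-π)..π, F2 r θ) + Real.log r * A1 r
        + (-(2 * lam) * (r * Real.log r)) * (∫ θ in (-π)..π, G1 r θ)
        + (-(2 * lam) * (Real.log r + 1)) * B r
        + (Real.log r / r) * (∫ θ in (-π)..π, Ftt r θ) := by
    intro r hr
    refine Eq.trans ?_ (lin5 _ _ _ _ _ _ _ _ _ (fun θ => G1 r θ) (fun θ => pdT ψ (γ r θ)) _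
      (sl F2 cF2 r) (sl F1 cF1 r) (sl G1 cG1 r) (c0T.comp (cγr r)) (sl Ftt cFtt r))
    refine intervalIntegral.integral_congr fun θ _ => ?_
    simp only [hH, nn r θ hr, hF2, hF1, hG1, hFtt, dAlem, Fin.sum_univ_two]
    rw [show ((ts + lam * r, xs + r • ee θ) : ℝ × E2) = γ r θ from rfl, symmXX 0 1 ψ hψ]
    have hc : Real.cos θ ^ 2 = 1 - Real.sin θ ^ 2 := by linarith [Real.sin_sq_add_cos_sq θ]
    generalize Real.cos θ = c at *
    generalize Real.sin θ = s at *
    generalize Real.log r = L at *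
    have hl2' : lam ^ 2 = 1 := by rw [sq, hl2]
    field_simp
    ring_nf
    simp only [hl2', hc]
    ring
  have hΦ : ∀ r ∈ Set.Ioi (0:ℝ), HasDerivAt (fun r => r * Real.log r * A1 r - A r
      - 2 * lam * (r * Real.log r * B r)) (∫ θ in (-π)..π, r * H (xs + r • ee θ)) r := by
    intro r hr
    have hr0 : (0:ℝ) < r := hr
    have hlog := Real.hasDerivAt_mul_log hr0.ne'
    have h := ((hlog.mul (DA1 r)).sub (DA r)).sub ((hlog.mul (DB r)).const_mul (2 * lam))
    refine h.congr_deriv ?_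
    rw [inner r hr0, Z r]
    simp only [hA1, hB]
    ring
  have contA : Continuous A := continuous_iff_continuousAt.2 fun r => (DA r).continuousAt
  have contA1 : Continuous A1 := continuous_iff_continuousAt.2 fun r => (DA1 r).continuousAt
  have contB : Continuous B := continuous_iff_continuousAt.2 fun r => (DB r).continuousAt
  have hcont : Continuous (fun r => r * Real.log r * A1 r - A r
      - 2 * lam * (r * Real.log r * B r)) := by
    have := Real.continuous_mul_log
    exact ((this.mul contA1).sub contA).sub ((this.mul contB).const_mul _)
  have la : Tendsto A atTop (nhds 0) := by
    refine lim0 A rs _ p0 hp0 (decay_int (fun r θ => ψ (γ r θ)) rs C0 p0 ?_)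
    intro r θ hr
    have h0 : 0 < r := by linarith
    have := hd0 (xs + r • ee θ) (by rw [nn r θ h0]; exact hr)
    rwa [narg r θ h0, nn r θ h0] at this
  have hT1 : ∀ r θ, rs < r → |pdT ψ (γ r θ)| ≤ C1 * r ^ (-p1) ∧
      ∀ i, |pdX i ψ (γ r θ)| ≤ C1 * r ^ (-p1) := by
    intro r θ hr
    have h0 : 0 < r := by linarith
    have := hd1 (xs + r • ee θ) (by rw [nn r θ h0]; exact hr)
    rwa [narg r θ h0, nn r θ h0] at this
  have lb : Tendsto (fun r => r * Real.log r * B r) atTop (nhds 0) :=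
    lim1 B rs _ p1 hp1 (decay_int (fun r θ => pdT ψ (γ r θ)) rs C1 p1
      fun r θ hr => (hT1 r θ hr).1)
  have la1 : Tendsto (fun r => r * Real.log r * A1 r) atTop (nhds 0) := by
    refine lim1 A1 rs _ p1 hp1 (decay_int F1 rs (3 * C1) p1 fun r θ hr => ?_)
    obtain ⟨h1, h2⟩ := hT1 r θ hr
    have e1 : |lam * pdT ψ (γ r θ)| ≤ C1 * r ^ (-p1) := by rw [abs_mul, hl1, one_mul]; exact h1
    have e2 : |Real.cos θ * pdX 0 ψ (γ r θ)| ≤ C1 * r ^ (-p1) := by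
      rw [abs_mul]
      have := mul_le_mul (Real.abs_cos_le_one θ) (h2 0) (abs_nonneg _) zero_le_one
      linarith
    have e3 : |Real.sin θ * pdX 1 ψ (γ r θ)| ≤ C1 * r ^ (-p1) := by
      rw [abs_mul]
      have := mul_le_mul (Real.abs_sin_le_one θ) (h2 1) (abs_nonneg _) zero_le_one
      linarith
    simp only [hF1]
    refine (abs_add_three _ _ _).trans ?_
    linarith
  have hlim : Tendsto (fun r => r * Real.log r * A1 r - A r
      - 2 * lam * (r * Real.log r * B r)) atTop (nhds 0) := by
    simpa using (la1.sub la).sub (lb.const_mul (2 * lam))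
  have fin := integral_Ioi_of_hasDerivAt_of_tendsto hcont.continuousWithinAt hΦ J1 hlim
  have hA0 : A 0 = 2 * π * ψ (ts, xs) := by
    simp only [hA, hγ, gam, mul_zero, add_zero, zero_smul, intervalIntegral.integral_const,
      smul_eq_mul]
    ring
  have tot : ∫ x, H x = 2 * π * ψ (ts, xs) := by
    rw [J2, fin, ← hA0]; simp
  rw [hHint] at tot
  have hpi := Real.pi_pos
  have e : ψ (ts, xs) = (1 / (2 * π)) * (2 * π * ψ (ts, xs)) := by field_simp
  rw [e, ← tot]
  ring
end

section
/- Let λ ∈ {−1, 1}, t* ∈ ℝ, x* ∈ ℝ, and let ψ : ℝ × ℝ → ℝ be twice continuously differentiable and satisfy the decay condition at (t*, x*, λ), where ∂_t and ∂_x denote the partial derivatives in the first (time) and second (space) variable and □ψ := ∂_x∂_xψ − ∂_t∂_tψ. Then the functions x ↦ |x − x*|·(□ψ)(t* + λ|x − x*|, x) and x ↦ (∂_tψ)(t* + λ|x − x*|, x) are Lebesgue integrable on ℝ and ψ(t*, x*) = (1/2)·∫_ℝ |x − x*|·(□ψ)(t* + λ|x − x*|, x) dx − λ·∫_ℝ (∂_tψ)(t*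 + λ|x − x*|, x) dx. -/
open MeasureTheory Real Filter

noncomputable def pdT1 (ψ : ℝ × ℝ → ℝ) (p : ℝ × ℝ) : ℝ :=
  deriv (fun s => ψ (s, p.2)) p.1

noncomputable def pdX1 (ψ : ℝ × ℝ → ℝ) (p : ℝ × ℝ) : ℝ :=
  deriv (fun y => ψ (p.1, y)) p.2

noncomputable def dAlem1 (ψ : ℝ × ℝ → ℝ) (p : ℝ × ℝ) : ℝ :=
  pdX1 (pdX1 ψ) p - pdT1 (pdT1 ψ) p
/-- The one-dimensional decay condition of ψ at (t*, x*, λ). -/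
def Decay1 (ψ : ℝ × ℝ → ℝ) (ts lam xs : ℝ) : Prop :=
  ∃ rs : ℝ, 0 < rs ∧
    (∃ p C : ℝ, 0 < p ∧ 0 < C ∧ ∀ x, rs < |x - xs| →
      |ψ (ts + lam * |x - xs|, x)| ≤ C * |x - xs| ^ (-p)) ∧
    (∃ p C : ℝ, 1 < p ∧ 0 < C ∧ ∀ x, rs < |x - xs| →
      |pdT1 ψ (ts + lam * |x - xs|, x)| ≤ C * |x - xs| ^ (-p) ∧
      |pdX1 ψ (ts + lam * |x - xs|, x)| ≤ C * |x - xs| ^ (-p)) ∧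
    (∃ p C : ℝ, 2 < p ∧ 0 < C ∧ ∀ x, rs < |x - xs| →
      |pdT1 (pdT1 ψ) (ts + lam * |x - xs|, x)| ≤ C * |x - xs| ^ (-p) ∧
      |pdX1 (pdX1 ψ) (ts + lam * |x - xs|, x)| ≤ C * |x - xs| ^ (-p))

theorem aux_pdT (f : ℝ × ℝ → ℝ) (hf : Differentiable ℝ f) (p : ℝ × ℝ) :
    pdT1 f p = fderiv ℝ f p (1, 0) := by
  have h1 : HasDerivAt (fun s : ℝ => (s, p.2)) ((1 : ℝ), (0 : ℝ)) p.1 :=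
    (hasDerivAt_id p.1).prodMk (hasDerivAt_const p.1 p.2)
  exact ((hf p).hasFDerivAt.comp_hasDerivAt p.1 h1).deriv

theorem aux_pdX (f : ℝ × ℝ → ℝ) (hf : Differentiable ℝ f) (p : ℝ × ℝ) :
    pdX1 f p = fderiv ℝ f p (0, 1) := by
  have h1 : HasDerivAt (fun s : ℝ => (p.1, s)) ((0 : ℝ), (1 : ℝ)) p.2 :=
    (hasDerivAt_const p.2 p.1).prodMk (hasDerivAt_id p.2)
  exact ((hf p).hasFDerivAt.comp_hasDerivAt p.2 h1).deriv

theorem aux_ray (f : ℝ × ℝ → ℝ) (hf : Differentiable ℝ f) (t x l s r : ℝ) :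
    HasDerivAt (fun r : ℝ => f (t + l * r, x + s * r))
      (l * pdT1 f (t + l * r, x + s * r) + s * pdX1 f (t + l * r, x + s * r)) r := by
  have h1 : HasDerivAt (fun r : ℝ => (t + l * r, x + s * r)) (l, s) r := by
    have := (((hasDerivAt_id r).const_mul l).const_add t).prodMk
      (((hasDerivAt_id r).const_mul s).const_add x)
    simpa using this
  have h2 := (hf (t + l * r, x + s * r)).hasFDerivAt.comp_hasDerivAt r h1
  rw [aux_pdT f hf, aux_pdX f hf]
  refine h2.congr_deriv ?_
  have e : ((l, s) : ℝ × ℝ) = l • ((1 : ℝ), (0 : ℝ)) + s • ((0 : ℝ), (1 : ℝ)) := by simp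
  rw [e, map_add, map_smul, map_smul, smul_eq_mul, smul_eq_mul]

theorem aux_T_eq (f : ℝ × ℝ → ℝ) (hf : Differentiable ℝ f) :
    pdT1 f = fun p => fderiv ℝ f p (1, 0) := funext (aux_pdT f hf)
theorem aux_X_eq (f : ℝ × ℝ → ℝ) (hf : Differentiable ℝ f) :
    pdX1 f = fun p => fderiv ℝ f p (0, 1) := funext (aux_pdX f hf)

theorem aux_T_contDiff (f : ℝ × ℝ → ℝ) (m n : WithTop ℕ∞) (hmn : m + 1 ≤ n) (hf : ContDiff ℝ n f) :
    ContDiff ℝ m (pdT1 f) := by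
  have hn : n ≠ 0 := by rintro rfl; simp at hmn
  rw [aux_T_eq f (hf.differentiable hn)]
  exact (hf.fderiv_right hmn).clm_apply contDiff_const

theorem aux_X_contDiff (f : ℝ × ℝ → ℝ) (m n : WithTop ℕ∞) (hmn : m + 1 ≤ n) (hf : ContDiff ℝ n f) :
    ContDiff ℝ m (pdX1 f) := by
  have hn : n ≠ 0 := by rintro rfl; simp at hmn
  rw [aux_X_eq f (hf.differentiable hn)]
  exact (hf.fderiv_right hmn).clm_apply contDiff_const

theorem aux_symm (f : ℝ × ℝ → ℝ) (hf : ContDiff ℝ 2 f) (p : ℝ × ℝ) :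
    pdT1 (pdX1 f) p = pdX1 (pdT1 f) p := by
  have h1 := aux_T_contDiff f 1 2 (by norm_num) hf
  have h2 := aux_X_contDiff f 1 2 (by norm_num) hf
  have hd : DifferentiableAt ℝ (fderiv ℝ f) p :=
    ((hf.fderiv_right (m := 1) (by norm_num)).differentiable (by norm_num)) p
  have hf1 : Differentiable ℝ f := hf.differentiable (by norm_num)
  rw [aux_pdT _ (h2.differentiable (by norm_num)), aux_pdX _ (h1.differentiable (by norm_num)),
    aux_T_eq f hf1, aux_X_eq f hf1]
  rw [fderiv_clm_apply hd (differentiableAt_const _), fderiv_clm_apply hd (differentiableAt_const _)]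
  have hs : IsSymmSndFDerivAt ℝ f p := hf.contDiffAt.isSymmSndFDerivAt (by simp)
  simpa using hs.eq (1, 0) (0, 1)

theorem aux_int (g : ℝ → ℝ) (hg : Continuous g) (R C p : ℝ) (hR : 0 < R) (hp : 1 < p)
    (h : ∀ r, R < r → |g r| ≤ C * r ^ (-p)) : IntegrableOn g (Set.Ioi 0) := by
  have h1 : IntegrableOn g (Set.Icc 0 R) := hg.continuousOn.integrableOn_Icc
  have h2 : IntegrableOn g (Set.Ioi R) := by
    refine Integrable.mono' ((integrableOn_Ioi_rpow_of_lt (a := -p) (by linarith) hR).const_mul C)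
      hg.aestronglyMeasurable ?_
    exact (ae_restrict_iff' measurableSet_Ioi).2 (Eventually.of_forall fun r hr => h r hr)
  refine (h1.union h2).mono_set ?_
  intro x hx
  rcases le_or_gt x R with h | h
  · exact Or.inl ⟨le_of_lt hx, h⟩
  · exact Or.inr h

theorem aux_split (g : ℝ → ℝ) (h1 : IntegrableOn g (Set.Ioi 0))
    (h2 : IntegrableOn (fun r => g (-r)) (Set.Ioi 0)) :
    Integrable g ∧ ∫ x, g x = (∫ x in Set.Ioi 0, g x) + ∫ x in Set.Ioi 0, g (-x) := by
  have h3 : IntegrableOn g (Set.Iic 0) := by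
    have h4 : IntegrableOn g (Set.Iio 0) := by
      have := (Measure.measurePreserving_neg (volume : Measure ℝ)).integrableOn_comp_preimage
        (Homeomorph.neg ℝ).measurableEmbedding (f := g) (s := Set.Iio 0)
      refine this.1 ?_
      have e : (Neg.neg ⁻¹' Set.Iio (0:ℝ)) = Set.Ioi 0 := by ext x; simp
      rw [e]
      exact h2
    exact (integrableOn_Iic_iff_integrableOn_Iio).2 h4
  have hi : Integrable g := by
    rw [← integrableOn_univ, ← Set.Iic_union_Ioi (a := (0:ℝ))]
    exact h3.union h1
  refine ⟨hi, ?_⟩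
  have := intervalIntegral.integral_Iic_add_Ioi h3 h1
  rw [← this, integral_comp_neg_Ioi, neg_zero, add_comm]

theorem aux_tend (g : ℝ → ℝ) (R C p : ℝ) (hp : 0 < p)
    (h : ∀ r, R < r → |g r| ≤ C * r ^ (-p)) : Tendsto g atTop (nhds 0) := by
  refine squeeze_zero_norm' (a := fun r => C * r ^ (-p)) ?_ ?_
  · filter_upwards [eventually_gt_atTop R] with r hr using h r hr
  · simpa using (tendsto_rpow_neg_atTop hp).const_mul C

theorem aux_main (lam : ℝ) (hlam : lam = -1 ∨ lam = 1) (s : ℝ) (hs : s = -1 ∨ s = 1) (ts xs : ℝ)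
    (ψ : ℝ × ℝ → ℝ) (hψ : ContDiff ℝ 2 ψ) (hdecay : Decay1 ψ ts lam xs) :
    IntegrableOn (fun r : ℝ => r * dAlem1 ψ (ts + lam * r, xs + s * r)) (Set.Ioi 0) ∧
    IntegrableOn (fun r : ℝ => pdT1 ψ (ts + lam * r, xs + s * r)) (Set.Ioi 0) ∧
    (∫ r in Set.Ioi (0:ℝ), r * dAlem1 ψ (ts + lam * r, xs + s * r))
      - 2 * lam * (∫ r in Set.Ioi (0:ℝ), pdT1 ψ (ts + lam * r, xs + s * r)) = ψ (ts, xs) := by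
  obtain ⟨R, hR, ⟨p0, C0, hp0, hC0, h0⟩, ⟨p1, C1, hp1, hC1, h1⟩, ⟨p2, C2, hp2, hC2, h2⟩⟩ := hdecay
  have hab : ∀ r, R < r → |xs + s * r - xs| = r := by
    intro r hr
    have : 0 < r := hR.trans hr
    rcases hs with rfl | rfl <;> simp [abs_of_pos this]
  have cT := aux_T_contDiff ψ 1 2 (by norm_num) hψ
  have cX := aux_X_contDiff ψ 1 2 (by norm_num) hψ
  have cTT : Continuous (pdT1 (pdT1 ψ)) := (aux_T_contDiff _ 0 1 (by norm_num) cT).continuous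
  have cXX : Continuous (pdX1 (pdX1 ψ)) := (aux_X_contDiff _ 0 1 (by norm_num) cX).continuous
  have cT' := cT.continuous
  have cX' := cX.continuous
  have k0 : ∀ r, R < r → |ψ (ts + lam * r, xs + s * r)| ≤ C0 * r ^ (-p0) := by
    intro r hr
    have := h0 (xs + s * r) (by rwa [hab r hr])
    rwa [hab r hr] at this
  have k1 : ∀ r, R < r → |pdT1 ψ (ts + lam * r, xs + s * r)| ≤ C1 * r ^ (-p1) ∧
      |pdX1 ψ (ts + lam * r, xs + s * r)| ≤ C1 * r ^ (-p1) := by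
    intro r hr
    have := h1 (xs + s * r) (by rwa [hab r hr])
    rwa [hab r hr] at this
  have k2 : ∀ r, R < r → |pdT1 (pdT1 ψ) (ts + lam * r, xs + s * r)| ≤ C2 * r ^ (-p2) ∧
      |pdX1 (pdX1 ψ) (ts + lam * r, xs + s * r)| ≤ C2 * r ^ (-p2) := by
    intro r hr
    have := h2 (xs + s * r) (by rwa [hab r hr])
    rwa [hab r hr] at this
  have hs1 : |s| = 1 := by rcases hs with rfl | rfl <;> simp
  have hl1 : |lam| = 1 := by rcases hlam with rfl | rfl <;> simp
  have hs2 : s * s = 1 := by rcases hs with rfl | rfl <;> simp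
  have hl2 : lam * lam = 1 := by rcases hlam with rfl | rfl <;> simp
  have hpow : ∀ r p : ℝ, R < r → r * r ^ (-p) = r ^ (-(p - 1)) := by
    intro r p hr
    rw [show -(p - 1) = 1 + -p by ring, rpow_add (hR.trans hr), rpow_one]
  have I1 : IntegrableOn (fun r : ℝ => r * dAlem1 ψ (ts + lam * r, xs + s * r)) (Set.Ioi 0) := by
    refine aux_int _ ?_ R (2 * C2) (p2 - 1) hR (by linarith) ?_
    · unfold dAlem1; fun_prop
    · intro r hr
      obtain ⟨a, b⟩ := k2 r hr
      have hr0 : 0 < r := hR.trans hr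
      rw [abs_mul, abs_of_pos hr0, ← hpow r p2 hr]
      have : |dAlem1 ψ (ts + lam * r, xs + s * r)| ≤ 2 * (C2 * r ^ (-p2)) := by
        unfold dAlem1
        exact (abs_sub _ _).trans (by linarith)
      nlinarith
  have I2 : IntegrableOn (fun r : ℝ => pdT1 ψ (ts + lam * r, xs + s * r)) (Set.Ioi 0) :=
    aux_int _ (by fun_prop) R C1 p1 hR hp1 fun r hr => (k1 r hr).1
  refine ⟨I1, I2, ?_⟩
  have hder : ∀ r ∈ Set.Ici (0:ℝ), HasDerivAt (fun r : ℝ =>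
      r * (s * pdX1 ψ (ts + lam * r, xs + s * r) - lam * pdT1 ψ (ts + lam * r, xs + s * r))
        - ψ (ts + lam * r, xs + s * r))
      (r * dAlem1 ψ (ts + lam * r, xs + s * r)
        - 2 * lam * pdT1 ψ (ts + lam * r, xs + s * r)) r := by
    intro r _
    have dX := aux_ray (pdX1 ψ) (cX.differentiable (by norm_num)) ts xs lam s r
    have dT := aux_ray (pdT1 ψ) (cT.differentiable (by norm_num)) ts xs lam s r
    have d0 := aux_ray ψ (hψ.differentiable (by norm_num)) ts xs lam s r
    have := ((hasDerivAt_id r).mul ((dX.const_mul s).sub (dT.const_mul lam))).sub d0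
    refine this.congr_deriv ?_
    rw [aux_symm ψ hψ]
    simp only [id, dAlem1, Pi.sub_apply]
    linear_combination (r * pdX1 (pdX1 ψ) (ts + lam * r, xs + s * r)) * hs2 +
      (-r * pdT1 (pdT1 ψ) (ts + lam * r, xs + s * r)) * hl2
  have hlim : Tendsto (fun r : ℝ =>
      r * (s * pdX1 ψ (ts + lam * r, xs + s * r) - lam * pdT1 ψ (ts + lam * r, xs + s * r))
        - ψ (ts + lam * r, xs + s * r)) atTop (nhds 0) := by
    have t1 := aux_tend _ R C0 p0 hp0 k0
    have t2 := aux_tend (fun r : ℝ =>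
      r * (s * pdX1 ψ (ts + lam * r, xs + s * r) - lam * pdT1 ψ (ts + lam * r, xs + s * r)))
      R (2 * C1) (p1 - 1) (by linarith) (by
        intro r hr
        obtain ⟨a, b⟩ := k1 r hr
        have hr0 : 0 < r := hR.trans hr
        rw [abs_mul, abs_of_pos hr0, ← hpow r p1 hr]
        have : |s * pdX1 ψ (ts + lam * r, xs + s * r) - lam * pdT1 ψ (ts + lam * r, xs + s * r)|
            ≤ 2 * (C1 * r ^ (-p1)) := by
          refine (abs_sub _ _).trans ?_
          rw [abs_mul, abs_mul, hs1, hl1]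
          linarith
        nlinarith)
    simpa using t2.sub t1
  have := integral_Ioi_of_hasDerivAt_of_tendsto' hder (I1.sub (I2.const_mul (2 * lam))) hlim
  rw [integral_sub I1 (I2.const_mul (2 * lam)), integral_const_mul] at this
  rw [this]
  simp

theorem aux_shift (F : ℝ × ℝ → ℝ) (G : ℝ → ℝ → ℝ) (lam ts xs : ℝ)
    (h1 : IntegrableOn (fun r : ℝ => G r (F (ts + lam * r, xs + 1 * r))) (Set.Ioi 0))
    (h2 : IntegrableOn (fun r : ℝ => G r (F (ts + lam * r, xs + (-1) * r))) (Set.Ioi 0)) :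
    Integrable (fun x : ℝ => G |x - xs| (F (ts + lam * |x - xs|, x))) ∧
    ∫ x : ℝ, G |x - xs| (F (ts + lam * |x - xs|, x)) =
      (∫ r in Set.Ioi (0:ℝ), G r (F (ts + lam * r, xs + 1 * r))) +
      ∫ r in Set.Ioi (0:ℝ), G r (F (ts + lam * r, xs + (-1) * r)) := by
  set g : ℝ → ℝ := fun y => G |y| (F (ts + lam * |y|, xs + y)) with hg
  have e : (fun x : ℝ => G |x - xs| (F (ts + lam * |x - xs|, x))) = fun x => g (x - xs) := by
    funext x; simp [hg]
  have e1 : Set.EqOn (fun r : ℝ => G r (F (ts + lam * r, xs + 1 * r))) g (Set.Ioi 0) := by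
    intro r hr
    simp [hg, abs_of_pos (show 0 < r from hr)]
  have e2 : Set.EqOn (fun r : ℝ => G r (F (ts + lam * r, xs + (-1) * r)))
      (fun r => g (-r)) (Set.Ioi 0) := by
    intro r hr
    simp [hg, abs_of_pos (show 0 < r from hr)]
  obtain ⟨a, b⟩ := aux_split g (h1.congr_fun e1 measurableSet_Ioi)
    (h2.congr_fun e2 measurableSet_Ioi)
  rw [e, setIntegral_congr_fun measurableSet_Ioi e1, setIntegral_congr_fun measurableSet_Ioi e2,
    integral_sub_right_eq_self g xs]
  exact ⟨a.comp_sub_right xs, b⟩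

/-- the boundary-free special second integro-differential formula in
dimension one (exhibiting the dispersive extra term). -/
theorem stmt_18 (lam : ℝ) (hlam : lam = -1 ∨ lam = 1) (ts xs : ℝ)
    (ψ : ℝ × ℝ → ℝ) (hψ : ContDiff ℝ 2 ψ) (hdecay : Decay1 ψ ts lam xs) :
    Integrable (fun x : ℝ => |x - xs| * dAlem1 ψ (ts + lam * |x - xs|, x)) ∧
    Integrable (fun x : ℝ => pdT1 ψ (ts + lam * |x - xs|, x)) ∧
    ψ (ts, xs)
      = (1 / 2) * (∫ x : ℝ, |x - xs| * dAlem1 ψ (ts + lam * |x - xs|, x))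
        - lam * (∫ x : ℝ, pdT1 ψ (ts + lam * |x - xs|, x)) := by
  obtain ⟨a1, a2, a3⟩ := aux_main lam hlam 1 (Or.inr rfl) ts xs ψ hψ hdecay
  obtain ⟨b1, b2, b3⟩ := aux_main lam hlam (-1) (Or.inl rfl) ts xs ψ hψ hdecay
  obtain ⟨c1, c2⟩ := aux_shift (dAlem1 ψ) (fun r z => r * z) lam ts xs a1 b1
  obtain ⟨d1, d2⟩ := aux_shift (pdT1 ψ) (fun _ z => z) lam ts xs a2 b2
  refine ⟨c1, d1, ?_⟩
  rw [c2, d2]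
  linear_combination (-1 / 2) * a3 + (-1 / 2) * b3
end
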